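/- arXiv:math/0412308 — 2 statements merged into one kernel-verified Lean document; each statement's English description precedes it below -/
import Mathlib

section
/- For any real numbers α and c, and all u, v in the closure W₀ of C_c^∞(D) in the first-order Sobolev norm, the identity Q_α(v,u) = (1-c) Q_{α-c}(v,u) + c Q̄_{c-1-α}(v,u) + (2cα + c(1-c)) ⟨v,u⟩ holds, where Q_α(v,u) = ⟨(α+W)v, (α+W)u⟩ and Q̄_β(v,u) = ⟨(β+W̄)v, (β+W̄)u⟩. -/
open MeasureTheory Complex Filter Topology Metric
open scoped ENNReal NNReal InnerProductSpace

noncomputable section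

/-- The Wirtinger derivative `∂f/∂w = ((∂/∂t) f - i (∂/∂s) f)/2`. -/
def dw (f : ℂ → ℂ) (w : ℂ) : ℂ :=
  (fderiv ℝ f w 1 - Complex.I * fderiv ℝ f w Complex.I) / 2

/-- The Wirtinger derivative `∂f/∂w̄ = ((∂/∂t) f + i (∂/∂s) f)/2`. -/
def dwbar (f : ℂ → ℂ) (w : ℂ) : ℂ :=
  (fderiv ℝ f w 1 + Complex.I * fderiv ℝ f w Complex.I) / 2

/-- The vector field `W = 2 i s ∂/∂w` acting on functions. -/
def Wop (f : ℂ → ℂ) (w : ℂ) : ℂ := 2 * Complex.I * (w.im : ℂ) * dw f w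

/-- The vector field `W̄ = -2 i s ∂/∂w̄` acting on functions. -/
def Wbar (f : ℂ → ℂ) (w : ℂ) : ℂ := -(2 * Complex.I * (w.im : ℂ)) * dwbar f w

/-- The upper half-plane `H² = {w : Im w > 0}` as a subset of `ℂ`. -/
def UHP : Set ℂ := {w : ℂ | 0 < w.im}

/-- The squared `L²` norm on `D` with respect to the hyperbolic measure `s⁻² dt ds`. -/
def hNormSq (D : Set ℂ) (f : ℂ → ℂ) : ℝ≥0∞ :=
  ∫⁻ w in D, (‖f w‖₊ : ℝ≥0∞) ^ 2 * ENNReal.ofReal ((w.im)⁻¹ ^ 2)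

/-- The hyperbolic `L²` inner product `⟨f, g⟩ = ∫_D f ḡ s⁻² dt ds` on `D`. -/
def hInner (D : Set ℂ) (f g : ℂ → ℂ) : ℂ :=
  ∫ w in D, f w * (starRingEnd ℂ) (g w) * ((((w.im)⁻¹ ^ 2 : ℝ)) : ℂ)

/-- Smooth functions compactly supported in `D`. -/
def IsTestFun (D : Set ℂ) (f : ℂ → ℂ) : Prop :=
  ContDiff ℝ (⊤ : ℕ∞) f ∧ HasCompactSupport f ∧ tsupport f ⊆ D

/-- `u` belongs to `W₀`, the closure of `C_c^∞(D)` in the first-order Sobolev norm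
`‖u‖² + ‖Wu‖² + ‖W̄u‖²`, with `Wu`, `Wbu` the induced extensions of `W u` and `W̄ u`. -/
def MemW0 (D : Set ℂ) (u Wu Wbu : ℂ → ℂ) : Prop :=
  AEStronglyMeasurable u (volume.restrict D) ∧
  AEStronglyMeasurable Wu (volume.restrict D) ∧
  AEStronglyMeasurable Wbu (volume.restrict D) ∧
  ∃ φ : ℕ → ℂ → ℂ, (∀ n, IsTestFun D (φ n)) ∧
    Tendsto (fun n => hNormSq D (fun w => φ n w - u w)) atTop (𝓝 0) ∧
    Tendsto (fun n => hNormSq D (fun w => Wop (φ n) w - Wu w)) atTop (𝓝 0) ∧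
    Tendsto (fun n => hNormSq D (fun w => Wbar (φ n) w - Wbu w)) atTop (𝓝 0)

/-- Membership in `L²(D)` with respect to the hyperbolic measure. -/
def HMemL2 (D : Set ℂ) (f : ℂ → ℂ) : Prop :=
  AEStronglyMeasurable f (volume.restrict D) ∧ hNormSq D f < ⊤

/-- The weighted function `f / s`, which turns the hyperbolic `L²` structure into the Euclidean
one. -/
def hScale (f : ℂ → ℂ) (w : ℂ) : ℂ := f w * ((w.im : ℂ))⁻¹

/-- The pairing of the derivatives of compactly supported smooth functions in two directions is
symmetric in these directions. -/
lemma integral_fderiv_mul_fderiv_comm {v g : ℂ → ℂ} (hv : ContDiff ℝ (⊤ : ℕ∞) v)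
    (hvc : HasCompactSupport v) (hg : ContDiff ℝ (⊤ : ℕ∞) g) (a b : ℂ) :
    ∫ w, fderiv ℝ v w a * fderiv ℝ g w b = ∫ w, fderiv ℝ v w b * fderiv ℝ g w a := by
  have hg' : ∀ y, ContDiff ℝ (⊤ : ℕ∞) (fun x => fderiv ℝ g x y) := fun y =>
    (hg.fderiv_right (m := (⊤ : ℕ∞)) (by simp)).clm_apply contDiff_const
  have hv' : ∀ y, Continuous (fun x => fderiv ℝ v x y) := fun y =>
    ((hv.fderiv_right (m := (⊤ : ℕ∞)) (by simp)).clm_apply contDiff_const).continuous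
  have hv'c : ∀ y, HasCompactSupport (fun x => fderiv ℝ v x y) := fun y =>
    hvc.fderiv_apply (𝕜 := ℝ) y
  have parts : ∀ a b : ℂ, ∫ w, v w * fderiv ℝ (fun x => fderiv ℝ g x b) w a
      = - ∫ w, fderiv ℝ v w a * fderiv ℝ g w b := by
    intro a b
    refine integral_mul_fderiv_eq_neg_fderiv_mul_of_integrable ?_ ?_ ?_ ?_ ?_
    · exact ((hv' a).mul (hg' b).continuous).integrable_of_hasCompactSupport
        ((hv'c a).mul_right)
    · refine (hv.continuous.mul ?_).integrable_of_hasCompactSupport (hvc.mul_right)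
      exact (((hg' b).fderiv_right (m := (⊤ : ℕ∞)) (by simp)).clm_apply contDiff_const).continuous
    · exact (hv.continuous.mul (hg' b).continuous).integrable_of_hasCompactSupport
        (hvc.mul_right)
    · exact fun x _ => (hv.differentiable (by simp)) x
    · exact fun x _ => ((hg' b).differentiable (by simp)) x
  have symm : ∀ w, fderiv ℝ (fun x => fderiv ℝ g x b) w a
      = fderiv ℝ (fun x => fderiv ℝ g x a) w b := by
    intro w
    have hd : DifferentiableAt ℝ (fderiv ℝ g) w :=
      ((hg.fderiv_right (m := (⊤ : ℕ∞)) (by simp)).differentiable (by simp)) w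
    have key : ∀ x y : ℂ, fderiv ℝ (fun z => fderiv ℝ g z x) w y
        = fderiv ℝ (fderiv ℝ g) w y x := by
      intro x y
      rw [fderiv_clm_apply hd (differentiableAt_const x)]
      simp
    rw [key, key]
    exact (hg.contDiffAt.isSymmSndFDerivAt
      (by rw [minSmoothness_of_isRCLikeNormedField]; exact WithTop.coe_le_coe.2 le_top)) a b
  have h1 := parts a b
  have h2 := parts b a
  simp_rw [symm] at h1
  rw [h1] at h2
  exact neg_injective h2

lemma integral_fderiv_apply_eq_zero {F : ℂ → ℂ} (hF : ContDiff ℝ (⊤ : ℕ∞) F)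
    (hFc : HasCompactSupport F) (a : ℂ) : ∫ w, fderiv ℝ F w a = 0 := by
  have hF' : Continuous (fun x => fderiv ℝ F x a) :=
    ((hF.fderiv_right (m := (⊤ : ℕ∞)) (by simp)).clm_apply contDiff_const).continuous
  have := integral_mul_fderiv_eq_neg_fderiv_mul_of_integrable (μ := (volume : Measure ℂ))
    (f := fun _ : ℂ => (1 : ℂ)) (g := F) (v := a) (by simp)
    (by simpa using hF'.integrable_of_hasCompactSupport (hFc.fderiv_apply (𝕜 := ℝ) a))
    (by simpa using hF.continuous.integrable_of_hasCompactSupport hFc)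
    (fun x _ => differentiableAt_const _) (fun x _ => (hF.differentiable (by simp)) x)
  simpa using this

lemma fderiv_conj_apply {u : ℂ → ℂ} {w : ℂ} (hu : DifferentiableAt ℝ u w) (a : ℂ) :
    fderiv ℝ (fun x => (starRingEnd ℂ) (u x)) w a = (starRingEnd ℂ) (fderiv ℝ u w a) := by
  have : HasFDerivAt (fun x => (starRingEnd ℂ) (u x))
      ((conjCLE : ℂ →L[ℝ] ℂ).comp (fderiv ℝ u w)) w :=
    (conjCLE : ℂ →L[ℝ] ℂ).hasFDerivAt.comp w hu.hasFDerivAt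
  rw [this.fderiv]
  simp

namespace IsTestFun

variable {D : Set ℂ} {φ ψ : ℂ → ℂ}

lemma differentiable (h : IsTestFun D φ) : Differentiable ℝ φ := h.1.differentiable (by simp)

lemma continuous_fderiv_apply (h : IsTestFun D φ) (a : ℂ) :
    Continuous (fun w => fderiv ℝ φ w a) :=
  ((h.1.fderiv_right (m := (⊤ : ℕ∞)) (by simp)).clm_apply contDiff_const).continuous

lemma fderiv_eq_zero (h : IsTestFun D φ) {w : ℂ} (hw : w ∉ D) : fderiv ℝ φ w = 0 :=
  fderiv_of_notMem_tsupport ℝ (fun hw' => hw (h.2.2 hw'))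

lemma memLp_fderiv_apply (h : IsTestFun D φ) (a : ℂ) :
    MemLp (fun w => fderiv ℝ φ w a) 2 (volume.restrict D) :=
  ((h.continuous_fderiv_apply a).memLp_of_hasCompactSupport
    (h.2.1.fderiv_apply (𝕜 := ℝ) a)).restrict D

lemma conj (h : IsTestFun D φ) : IsTestFun D (fun w => (starRingEnd ℂ) (φ w)) := by
  have hs : tsupport (fun w => (starRingEnd ℂ) (φ w)) ⊆ tsupport φ := by
    refine closure_mono fun w hw => ?_
    simpa using hw
  exact ⟨(conjCLE : ℂ →L[ℝ] ℂ).contDiff.comp h.1,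
    h.2.1.of_isClosed_subset (isClosed_tsupport _) hs, hs.trans h.2.2⟩

lemma mul (h : IsTestFun D φ) (k : IsTestFun D ψ) : IsTestFun D (fun w => φ w * ψ w) :=
  ⟨h.1.mul k.1, h.2.1.mul_right, (tsupport_mul_subset_left).trans h.2.2⟩

lemma scaled (hDU : D ⊆ UHP) (h : IsTestFun D φ) : IsTestFun D (hScale φ) := by
  have hs : tsupport (hScale φ) ⊆ tsupport φ := tsupport_mul_subset_left
  refine ⟨contDiff_iff_contDiffAt.2 fun w => ?_,
    h.2.1.of_isClosed_subset (isClosed_tsupport _) hs, hs.trans h.2.2⟩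
  by_cases hw : w ∈ tsupport φ
  · have hpos : 0 < w.im := hDU (h.2.2 hw)
    refine h.1.contDiffAt.mul (ContDiffAt.inv ?_ (by exact_mod_cast hpos.ne'))
    exact (ofRealCLM.contDiff.comp imCLM.contDiff).contDiffAt
  · have h0 : hScale φ =ᶠ[𝓝 w] fun _ => 0 := by
      filter_upwards [notMem_tsupport_iff_eventuallyEq.1 hw] with x hx
      simp [hScale, hx]
    exact contDiffAt_const.congr_of_eventuallyEq h0

lemma memLp (h : IsTestFun D φ) : MemLp φ 2 (volume.restrict D) :=
  (h.1.continuous.memLp_of_hasCompactSupport h.2.1).restrict D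

lemma memLp_dw (h : IsTestFun D φ) : MemLp (dw φ) 2 (volume.restrict D) := by
  convert ((h.memLp_fderiv_apply 1).sub ((h.memLp_fderiv_apply I).const_mul I)).const_mul
    (2⁻¹ : ℂ) using 1
  ext w
  simp only [dw, Pi.sub_apply]
  ring

lemma memLp_dwbar (h : IsTestFun D φ) : MemLp (dwbar φ) 2 (volume.restrict D) := by
  convert ((h.memLp_fderiv_apply 1).add ((h.memLp_fderiv_apply I).const_mul I)).const_mul
    (2⁻¹ : ℂ) using 1
  ext w
  simp only [dwbar, Pi.add_apply]
  ring

end IsTestFun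

lemma hScale_Wop {f : ℂ → ℂ} {w : ℂ} (hw : w.im ≠ 0) : hScale (Wop f) w = 2 * I * dw f w := by
  have : (w.im : ℂ) ≠ 0 := by exact_mod_cast hw
  simp only [hScale, Wop]
  field_simp

lemma hScale_Wbar {f : ℂ → ℂ} {w : ℂ} (hw : w.im ≠ 0) :
    hScale (Wbar f) w = -(2 * I * dwbar f w) := by
  have : (w.im : ℂ) ≠ 0 := by exact_mod_cast hw
  simp only [hScale, Wbar]
  field_simp

lemma hInner_eq_integral_hScale (D : Set ℂ) (f g : ℂ → ℂ) :
    hInner D f g = ∫ w in D, hScale f w * (starRingEnd ℂ) (hScale g w) := by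
  unfold hInner hScale
  congr 1 with w
  simp only [map_mul, map_inv₀, conj_ofReal]
  push_cast
  ring

lemma hNormSq_eq_eLpNorm_hScale (D : Set ℂ) (f : ℂ → ℂ) :
    hNormSq D f = eLpNorm (hScale f) 2 (volume.restrict D) ^ 2 := by
  rw [← ENNReal.rpow_natCast, eLpNorm_eq_lintegral_rpow_enorm_toReal (by simp) (by simp),
    ← ENNReal.rpow_mul]
  simp only [hNormSq, ENNReal.toReal_ofNat, one_div, Nat.cast_ofNat, ne_eq, OfNat.ofNat_ne_zero,
    not_false_eq_true, inv_mul_cancel₀, ENNReal.rpow_one]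
  refine lintegral_congr fun w => ?_
  rw [hScale, enorm_mul, ENNReal.mul_rpow_of_nonneg _ _ (by norm_num), ENNReal.rpow_ofNat,
    ENNReal.rpow_ofNat, enorm_eq_nnnorm, ← ofReal_inv, ← ofReal_norm (((w.im)⁻¹ : ℝ) : ℂ),
    ← ENNReal.ofReal_pow (norm_nonneg _)]
  simp

lemma MeasureTheory.AEStronglyMeasurable.hScale {D : Set ℂ} {f : ℂ → ℂ}
    (hf : AEStronglyMeasurable f (volume.restrict D)) :
    AEStronglyMeasurable (hScale f) (volume.restrict D) :=
  hf.mul (measurable_ofReal.comp measurable_im).inv.aestronglyMeasurable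

lemma hInner_eq_inner {D : Set ℂ} {f g : ℂ → ℂ} (hf : MemLp (hScale f) 2 (volume.restrict D))
    (hg : MemLp (hScale g) 2 (volume.restrict D)) :
    hInner D f g = ⟪hg.toLp, hf.toLp⟫_ℂ := by
  rw [hInner_eq_integral_hScale, L2.inner_def]
  refine integral_congr_ae ?_
  filter_upwards [hf.coeFn_toLp, hg.coeFn_toLp] with w h1 h2
  rw [h1, h2, RCLike.inner_apply]

lemma integrable_hScale_mul_conj {D : Set ℂ} {f g : ℂ → ℂ}
    (hf : MemLp (hScale f) 2 (volume.restrict D)) (hg : MemLp (hScale g) 2 (volume.restrict D)) :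
    Integrable (fun w => hScale f w * (starRingEnd ℂ) (hScale g w)) (volume.restrict D) :=
  hf.integrable_mul hg.star

lemma hInner_conj_symm (D : Set ℂ) (f g : ℂ → ℂ) :
    (starRingEnd ℂ) (hInner D f g) = hInner D g f := by
  rw [hInner_eq_integral_hScale, hInner_eq_integral_hScale, ← integral_conj]
  congr 1 with w
  simp [mul_comm]

/-- Sesquilinear expansion of the hyperbolic inner product. -/
lemma hInner_mul_add_mul_add {D : Set ℂ} {f F g G : ℂ → ℂ} (a b : ℝ)
    (hf : MemLp (hScale f) 2 (volume.restrict D)) (hF : MemLp (hScale F) 2 (volume.restrict D))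
    (hg : MemLp (hScale g) 2 (volume.restrict D)) (hG : MemLp (hScale G) 2 (volume.restrict D)) :
    hInner D (fun w => (a : ℂ) * f w + F w) (fun w => (b : ℂ) * g w + G w)
      = a * b * hInner D f g + a * hInner D f G + b * hInner D F g + hInner D F G := by
  have scale : ∀ (a : ℝ) (f F : ℂ → ℂ),
      hScale (fun w => (a : ℂ) * f w + F w) = (a : ℂ) • hScale f + hScale F := by
    intro a f F
    ext w
    simp only [hScale, Pi.add_apply, Pi.smul_apply, smul_eq_mul]
    ring
  have h1 : MemLp (hScale (fun w => (a : ℂ) * f w + F w)) 2 (volume.restrict D) := by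
    rw [scale]; exact (hf.const_smul _).add hF
  have h2 : MemLp (hScale (fun w => (b : ℂ) * g w + G w)) 2 (volume.restrict D) := by
    rw [scale]; exact (hg.const_smul _).add hG
  have e1 : h1.toLp = (a : ℂ) • hf.toLp + hF.toLp := by
    simp only [scale]; rfl
  have e2 : h2.toLp = (b : ℂ) • hg.toLp + hG.toLp := by
    simp only [scale]; rfl
  rw [hInner_eq_inner h1 h2, hInner_eq_inner hf hg, hInner_eq_inner hf hG, hInner_eq_inner hF hg,
    hInner_eq_inner hF hG, e1, e2]
  simp only [inner_add_left, inner_add_right, inner_smul_left, inner_smul_right, conj_ofReal]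
  ring

lemma hScale_sub (f g : ℂ → ℂ) : hScale (fun w => f w - g w) = hScale f - hScale g := by
  ext w
  simp [hScale, sub_mul]

lemma tendsto_eLpNorm_hScale_sub {D : Set ℂ} {f : ℕ → ℂ → ℂ} {g : ℂ → ℂ}
    (h : Tendsto (fun n => hNormSq D (fun w => f n w - g w)) atTop (𝓝 0)) :
    Tendsto (fun n => eLpNorm (hScale (f n) - hScale g) 2 (volume.restrict D)) atTop (𝓝 0) := by
  have h' := (ENNReal.continuous_rpow_const (y := (2 : ℝ)⁻¹)).tendsto 0 |>.comp h
  rw [ENNReal.zero_rpow_of_pos (by norm_num)] at h'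
  refine h'.congr fun n => ?_
  rw [Function.comp_apply, hNormSq_eq_eLpNorm_hScale, hScale_sub, ← ENNReal.rpow_ofNat,
    ← ENNReal.rpow_mul]
  simp

lemma memLp_hScale_of_tendsto {D : Set ℂ} {f : ℕ → ℂ → ℂ} {g : ℂ → ℂ}
    (hf : ∀ n, MemLp (hScale (f n)) 2 (volume.restrict D))
    (hg : AEStronglyMeasurable g (volume.restrict D))
    (h : Tendsto (fun n => hNormSq D (fun w => f n w - g w)) atTop (𝓝 0)) :
    MemLp (hScale g) 2 (volume.restrict D) := by
  obtain ⟨n, hn⟩ := ((tendsto_eLpNorm_hScale_sub h).eventually_lt_const ENNReal.zero_lt_top).exists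
  have hd : MemLp (hScale (f n) - hScale g) 2 (volume.restrict D) :=
    ⟨(hf n).1.sub hg.hScale, hn⟩
  simpa using (hf n).sub hd

/-- The hyperbolic inner product is continuous in the hyperbolic `L²` norm. -/
lemma tendsto_hInner {D : Set ℂ} {f g : ℕ → ℂ → ℂ} {f' g' : ℂ → ℂ}
    (hf : ∀ n, MemLp (hScale (f n)) 2 (volume.restrict D))
    (hg : ∀ n, MemLp (hScale (g n)) 2 (volume.restrict D))
    (hf' : AEStronglyMeasurable f' (volume.restrict D))
    (hg' : AEStronglyMeasurable g' (volume.restrict D))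
    (hff' : Tendsto (fun n => hNormSq D (fun w => f n w - f' w)) atTop (𝓝 0))
    (hgg' : Tendsto (fun n => hNormSq D (fun w => g n w - g' w)) atTop (𝓝 0)) :
    Tendsto (fun n => hInner D (f n) (g n)) atTop (𝓝 (hInner D f' g')) := by
  have mf := memLp_hScale_of_tendsto hf hf' hff'
  have mg := memLp_hScale_of_tendsto hg hg' hgg'
  have tf := (Lp.tendsto_Lp_iff_tendsto_eLpNorm'' _ hf _ mf).2 (tendsto_eLpNorm_hScale_sub hff')
  have tg := (Lp.tendsto_Lp_iff_tendsto_eLpNorm'' _ hg _ mg).2 (tendsto_eLpNorm_hScale_sub hgg')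
  rw [hInner_eq_inner mf mg]
  exact (tg.inner tf).congr fun n => (hInner_eq_inner (hf n) (hg n)).symm

lemma ae_restrict_im_ne_zero {D : Set ℂ} (hD : IsOpen D) (hDU : D ⊆ UHP) :
    ∀ᵐ w ∂(volume.restrict D), w.im ≠ 0 := by
  filter_upwards [ae_restrict_mem hD.measurableSet] with w hw
  exact (hDU hw).ne'

namespace IsTestFun

variable {D : Set ℂ} {u v : ℂ → ℂ}

lemma memLp_hScale (hDU : D ⊆ UHP) (h : IsTestFun D u) :
    MemLp (hScale u) 2 (volume.restrict D) :=
  (h.scaled hDU).memLp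

lemma memLp_hScale_Wop (hD : IsOpen D) (hDU : D ⊆ UHP) (h : IsTestFun D u) :
    MemLp (hScale (Wop u)) 2 (volume.restrict D) := by
  refine (h.memLp_dw.const_mul (2 * I)).ae_eq ?_
  filter_upwards [ae_restrict_im_ne_zero hD hDU] with w hw
  rw [hScale_Wop hw]

lemma memLp_hScale_Wbar (hD : IsOpen D) (hDU : D ⊆ UHP) (h : IsTestFun D u) :
    MemLp (hScale (Wbar u)) 2 (volume.restrict D) := by
  refine (h.memLp_dwbar.const_mul (2 * I)).neg.ae_eq ?_
  filter_upwards [ae_restrict_im_ne_zero hD hDU] with w hw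
  rw [hScale_Wbar hw, Pi.neg_apply]

/-- `⟨W v, W u⟩ = ⟨W̄ v, W̄ u⟩` for test functions. -/
lemma hInner_Wop_Wop (hD : IsOpen D) (hDU : D ⊆ UHP) (hv : IsTestFun D v) (hu : IsTestFun D u) :
    hInner D (Wop v) (Wop u) = hInner D (Wbar v) (Wbar u) := by
  set g : ℂ → ℂ := fun w => (starRingEnd ℂ) (u w) with hg
  have hgt : IsTestFun D g := hu.conj
  have hint : ∀ a b : ℂ, Integrable (fun w => fderiv ℝ v w a * fderiv ℝ g w b) := fun a b =>
    ((hv.continuous_fderiv_apply a).mul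
      (hgt.continuous_fderiv_apply b)).integrable_of_hasCompactSupport
      ((hv.2.1.fderiv_apply (𝕜 := ℝ) a).mul_right)
  have hint' := fun a b => (hint a b).integrableOn (s := D)
  have hset : ∀ a b : ℂ, ∫ w in D, fderiv ℝ v w a * fderiv ℝ g w b
      = ∫ w, fderiv ℝ v w a * fderiv ℝ g w b := fun a b =>
    setIntegral_eq_integral_of_forall_compl_eq_zero fun w hw => by
      simp [hv.fderiv_eq_zero hw]
  rw [hInner_eq_integral_hScale, hInner_eq_integral_hScale, ← sub_eq_zero, ← integral_sub]
  · have key : ∀ᵐ w ∂(volume.restrict D),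
        hScale (Wop v) w * (starRingEnd ℂ) (hScale (Wop u) w)
          - hScale (Wbar v) w * (starRingEnd ℂ) (hScale (Wbar u) w)
        = 2 * I * (fderiv ℝ v w 1 * fderiv ℝ g w I - fderiv ℝ v w I * fderiv ℝ g w 1) := by
      filter_upwards [ae_restrict_im_ne_zero hD hDU] with w hw
      rw [hScale_Wop hw, hScale_Wop hw, hScale_Wbar hw, hScale_Wbar hw, hg,
        fderiv_conj_apply (hu.differentiable w), fderiv_conj_apply (hu.differentiable w)]
      simp only [dw, dwbar, map_neg, map_mul, map_div₀, map_add, map_sub, conj_I, map_ofNat]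
      linear_combination (-2 * I * (fderiv ℝ v w 1 * (starRingEnd ℂ) (fderiv ℝ u w I)
        - fderiv ℝ v w I * (starRingEnd ℂ) (fderiv ℝ u w 1))) * I_sq
    rw [integral_congr_ae key, integral_const_mul, integral_sub (hint' 1 I) (hint' I 1),
      hset, hset, integral_fderiv_mul_fderiv_comm hv.1 hv.2.1 hgt.1 1 I, sub_self, mul_zero]
  · exact integrable_hScale_mul_conj (hv.memLp_hScale_Wop hD hDU) (hu.memLp_hScale_Wop hD hDU)
  · exact integrable_hScale_mul_conj (hv.memLp_hScale_Wbar hD hDU) (hu.memLp_hScale_Wbar hD hDU)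

/-- The adjoint relation `W* = 1 - W̄` for test functions. -/
lemma hInner_Wop_add_hInner_Wbar (hD : IsOpen D) (hDU : D ⊆ UHP) (hv : IsTestFun D v)
    (hu : IsTestFun D u) : hInner D (Wop v) u + hInner D v (Wbar u) = hInner D v u := by
  set F : ℂ → ℂ := hScale (fun w => v w * (starRingEnd ℂ) (u w))
  have hFt : IsTestFun D F := (hv.mul hu.conj).scaled hDU
  have hFi : ∀ a, IntegrableOn (fun w => fderiv ℝ F w a) D := fun a =>
    ((hFt.continuous_fderiv_apply a).integrable_of_hasCompactSupport
      (hFt.2.1.fderiv_apply (𝕜 := ℝ) a)).integrableOn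
  have hset : ∀ a : ℂ, ∫ w in D, fderiv ℝ F w a = 0 := fun a => by
    rw [setIntegral_eq_integral_of_forall_compl_eq_zero fun w hw => by
      simp [hFt.fderiv_eq_zero hw], integral_fderiv_apply_eq_zero hFt.1 hFt.2.1]
  have i1 := integrable_hScale_mul_conj (hv.memLp_hScale_Wop hD hDU) (hu.memLp_hScale hDU)
  have i2 := integrable_hScale_mul_conj (hv.memLp_hScale hDU)
    (hu.memLp_hScale_Wbar hD hDU)
  have i3 := integrable_hScale_mul_conj (hv.memLp_hScale hDU) (hu.memLp_hScale hDU)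
  rw [hInner_eq_integral_hScale, hInner_eq_integral_hScale, hInner_eq_integral_hScale,
    ← sub_eq_zero, ← integral_add i1 i2, ← integral_sub (by exact i1.add i2) i3]
  have key : ∀ᵐ w ∂(volume.restrict D),
      hScale (Wop v) w * (starRingEnd ℂ) (hScale u w)
        + hScale v w * (starRingEnd ℂ) (hScale (Wbar u) w)
        - hScale v w * (starRingEnd ℂ) (hScale u w)
      = I * fderiv ℝ F w 1 + fderiv ℝ F w I := by
    filter_upwards [ae_restrict_im_ne_zero hD hDU] with w hw
    have hw' : (w.im : ℂ) ≠ 0 := by exact_mod_cast hw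
    have d1 := (hv.differentiable w).hasFDerivAt
    have d2 := (hu.conj.differentiable w).hasFDerivAt
    have d3 : HasFDerivAt (fun w : ℂ => (w.im : ℂ)) (ofRealCLM.comp imCLM) w :=
      (ofRealCLM.comp imCLM).hasFDerivAt
    have d4 := (hasDerivAt_inv hw').comp_hasFDerivAt_of_eq w d3 rfl
    have d5 := (d1.mul d2).mul d4
    have hFw : ∀ a : ℂ, fderiv ℝ F w a
        = (v w * (starRingEnd ℂ) (fderiv ℝ u w a) + fderiv ℝ v w a * (starRingEnd ℂ) (u w))
            * (w.im : ℂ)⁻¹ - v w * (starRingEnd ℂ) (u w) * ((w.im : ℂ) ^ 2)⁻¹ * (a.im : ℂ) := by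
      intro a
      rw [← fderiv_conj_apply (hu.differentiable w)]
      have hFd : HasFDerivAt F _ w := d5
      rw [hFd.fderiv]
      simp
      ring
    rw [hScale_Wop hw, hScale_Wbar hw, hFw, hFw]
    simp only [hScale, dw, dwbar, map_neg, map_mul, map_div₀, map_add, conj_I, map_ofNat,
      map_inv₀, conj_ofReal, one_im, I_im, ofReal_zero, ofReal_one]
    field_simp
    ring_nf
    simp only [I_sq]
    ring
  rw [integral_congr_ae key, integral_add ((hFi 1).const_mul I) (hFi I), integral_const_mul,
    hset, hset, mul_zero, add_zero]

end IsTestFun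

lemma IsTestFun.hInner_Wbar_add_hInner_Wop {D : Set ℂ} {u v : ℂ → ℂ} (hD : IsOpen D)
    (hDU : D ⊆ UHP) (hv : IsTestFun D v) (hu : IsTestFun D u) :
    hInner D (Wbar v) u + hInner D v (Wop u) = hInner D v u := by
  have := congrArg (starRingEnd ℂ) (hu.hInner_Wop_add_hInner_Wbar hD hDU hv)
  rwa [map_add, hInner_conj_symm, hInner_conj_symm, hInner_conj_symm, add_comm] at this

/-- the fundamental identity
`Q_α(v,u) = (1-c) Q_{α-c}(v,u) + c Q̄_{c-1-α}(v,u) + (2cα + c(1-c))⟨v,u⟩`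
for all `u, v` (with their first-order derivatives `Wu, W̄u, Wv, W̄v`) in the closure `W₀`
of `C_c^∞(D)` in the first-order Sobolev norm. -/
theorem fundamental_identity (D : Set ℂ) (hD : IsOpen D) (hDU : D ⊆ UHP)
    (hbd : Bornology.IsBounded D) (α c : ℝ)
    (u Wu Wbu v Wv Wbv : ℂ → ℂ)
    (hu : MemW0 D u Wu Wbu) (hv : MemW0 D v Wv Wbv) :
    hInner D (fun w => (α : ℂ) * v w + Wv w) (fun w => (α : ℂ) * u w + Wu w)
      = (1 - (c : ℂ)) *
          hInner D (fun w => ((α - c : ℝ) : ℂ) * v w + Wv w)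
            (fun w => ((α - c : ℝ) : ℂ) * u w + Wu w)
        + (c : ℂ) *
          hInner D (fun w => ((c - 1 - α : ℝ) : ℂ) * v w + Wbv w)
            (fun w => ((c - 1 - α : ℝ) : ℂ) * u w + Wbu w)
        + ((2 * c * α + c * (1 - c) : ℝ) : ℂ) * hInner D v u := by
  obtain ⟨mu, mWu, mWbu, φ, hφ, tu, tWu, tWbu⟩ := hu
  obtain ⟨mv, mWv, mWbv, ψ, hψ, tv, tWv, tWbv⟩ := hv
  have lφ := fun n => (hφ n).memLp_hScale hDU
  have lWφ := fun n => (hφ n).memLp_hScale_Wop hD hDU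
  have lWbφ := fun n => (hφ n).memLp_hScale_Wbar hD hDU
  have lψ := fun n => (hψ n).memLp_hScale hDU
  have lWψ := fun n => (hψ n).memLp_hScale_Wop hD hDU
  have lWbψ := fun n => (hψ n).memLp_hScale_Wbar hD hDU
  have hadj : hInner D Wv u + hInner D v Wbu = hInner D v u :=
    tendsto_nhds_unique
      (((tendsto_hInner lWψ lφ mWv mu tWv tu).add (tendsto_hInner lψ lWbφ mv mWbu tv tWbu)).congr
        fun n => (hψ n).hInner_Wop_add_hInner_Wbar hD hDU (hφ n))
      (tendsto_hInner lψ lφ mv mu tv tu)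
  have hadj' : hInner D Wbv u + hInner D v Wu = hInner D v u :=
    tendsto_nhds_unique
      (((tendsto_hInner lWbψ lφ mWbv mu tWbv tu).add (tendsto_hInner lψ lWφ mv mWu tv tWu)).congr
        fun n => (hψ n).hInner_Wbar_add_hInner_Wop hD hDU (hφ n))
      (tendsto_hInner lψ lφ mv mu tv tu)
  have hcomm : hInner D Wv Wu = hInner D Wbv Wbu :=
    tendsto_nhds_unique
      ((tendsto_hInner lWψ lWφ mWv mWu tWv tWu).congr
        fun n => (hψ n).hInner_Wop_Wop hD hDU (hφ n))
      (tendsto_hInner lWbψ lWbφ mWbv mWbu tWbv tWbu)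
  have ku := memLp_hScale_of_tendsto lφ mu tu
  have kWu := memLp_hScale_of_tendsto lWφ mWu tWu
  have kWbu := memLp_hScale_of_tendsto lWbφ mWbu tWbu
  have kv := memLp_hScale_of_tendsto lψ mv tv
  have kWv := memLp_hScale_of_tendsto lWψ mWv tWv
  have kWbv := memLp_hScale_of_tendsto lWbψ mWbv tWbv
  rw [hInner_mul_add_mul_add _ _ kv kWv ku kWu, hInner_mul_add_mul_add _ _ kv kWv ku kWu,
    hInner_mul_add_mul_add _ _ kv kWbv ku kWbu]
  push_cast
  linear_combination (-(c : ℂ) * (c - 1 - α)) * (hadj + hadj') + c * hcomm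
end
end

section
/- If α ≥ 1/2, then 2α ‖u‖² ≤ ‖(α+W)u‖² for all u in W₀. -/
open MeasureTheory Complex Filter Topology Metric
open scoped ENNReal NNReal InnerProductSpace

noncomputable section

section Vanishing

variable {E : Type*} [NormedAddCommGroup E] [NormedSpace ℝ E]
  [MeasurableSpace E] [BorelSpace E] {μ : Measure E} [μ.IsAddHaarMeasure]

lemma integrable_fderiv_apply {f : E → ℂ} (hf : ContDiff ℝ 1 f) (hc : HasCompactSupport f)
    (v : E) : Integrable (fun x => fderiv ℝ f x v) μ :=
  ((hf.continuous_fderiv one_ne_zero).clm_apply continuous_const).integrable_of_hasCompactSupport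
    (hc.fderiv_apply (𝕜 := ℝ) v)

variable [FiniteDimensional ℝ E]

lemma integral_fderiv_apply_eq_zero_s3 {f : E → ℂ} (hf : ContDiff ℝ 1 f)
    (hc : HasCompactSupport f) (v : E) : ∫ x, fderiv ℝ f x v ∂μ = 0 := by
  have h := integral_mul_fderiv_eq_neg_fderiv_mul_of_integrable (μ := μ) (v := v)
    (f := fun _ => (1 : ℂ)) (g := f) (by simp)
    (by simpa using integrable_fderiv_apply hf hc v)
    (by simpa using hf.continuous.integrable_of_hasCompactSupport hc)
    (fun x _ => differentiableAt_const _) (fun x _ => hf.differentiable one_ne_zero x)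
  simpa using h

lemma integral_fderiv_mul_fderiv_comm_s3 {f g : E → ℂ} (hf : ContDiff ℝ 2 f) (hg : ContDiff ℝ 2 g)
    (hc : HasCompactSupport g) (v w : E) :
    ∫ x, fderiv ℝ f x v * fderiv ℝ g x w ∂μ = ∫ x, fderiv ℝ f x w * fderiv ℝ g x v ∂μ := by
  have hd (v : E) : ContDiff ℝ 1 (fun x => fderiv ℝ f x v) :=
    (hf.fderiv_right (m := 1) (by norm_num)).clm_apply contDiff_const
  have hcont (v w : E) : Continuous fun x => fderiv ℝ (fun y => fderiv ℝ f y v) x w :=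
    ((hd v).continuous_fderiv one_ne_zero).clm_apply continuous_const
  have hg' (w : E) : Continuous fun x => fderiv ℝ g x w :=
    (hg.continuous_fderiv two_ne_zero).clm_apply continuous_const
  have key (v w : E) : ∫ x, fderiv ℝ f x v * fderiv ℝ g x w ∂μ
      = - ∫ x, fderiv ℝ (fun y => fderiv ℝ f y v) x w * g x ∂μ :=
    integral_mul_fderiv_eq_neg_fderiv_mul_of_integrable
      (((hcont v w).mul hg.continuous).integrable_of_hasCompactSupport hc.mul_left)
      (((hd v).continuous.mul (hg' w)).integrable_of_hasCompactSupport
        (hc.fderiv_apply (𝕜 := ℝ) w).mul_left)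
      (((hd v).continuous.mul hg.continuous).integrable_of_hasCompactSupport hc.mul_left)
      (fun x _ => (hd v).differentiable one_ne_zero x)
      (fun x _ => hg.differentiable two_ne_zero x)
  have hsymm (x : E) : fderiv ℝ (fun y => fderiv ℝ f y v) x w
      = fderiv ℝ (fun y => fderiv ℝ f y w) x v := by
    have hdf : DifferentiableAt ℝ (fderiv ℝ f) x :=
      (hf.fderiv_right (m := 1) (by norm_num)).differentiable one_ne_zero x
    rw [fderiv_clm_apply hdf (differentiableAt_const _),
      fderiv_clm_apply hdf (differentiableAt_const _)]
    simpa using (hf.contDiffAt.isSymmSndFDerivAt (x := x) (by simp)) w v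
  rw [key v w, key w v]
  simp_rw [hsymm]

end Vanishing

lemma integrable_norm_sq {f : ℂ → ℂ} (hf : Continuous f) (hc : HasCompactSupport f) :
    Integrable fun w => ‖f w‖ ^ 2 := by
  refine (hf.norm.pow 2).integrable_of_hasCompactSupport (hc.mono fun w hw => ?_)
  simpa using hw

lemma fderiv_star_apply (f : ℂ → ℂ) (w v : ℂ) :
    fderiv ℝ (fun z => star (f z)) w v = star (fderiv ℝ f w v) := by
  rw [fderiv_star]; rfl

lemma energy_identity {φ ψ : ℂ → ℂ} (hφ : ContDiff ℝ 2 φ) (hψ : ContDiff ℝ 2 ψ)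
    (hφc : HasCompactSupport φ) (hψc : HasCompactSupport ψ) (h : ∀ w, φ w = w.im * ψ w) (α : ℝ) :
    ∫ w, ‖α * ψ w + (I * fderiv ℝ φ w 1 + fderiv ℝ φ w I)‖ ^ 2
      = 2 * α * (∫ w, ‖ψ w‖ ^ 2)
        + ∫ w, ‖α * ψ w + (I * fderiv ℝ φ w 1 - fderiv ℝ φ w I)‖ ^ 2 := by
  have hd (v : ℂ) : Continuous fun w => fderiv ℝ φ w v :=
    (hφ.continuous_fderiv two_ne_zero).clm_apply continuous_const
  have hdc (v : ℂ) : HasCompactSupport fun w => fderiv ℝ φ w v := hφc.fderiv_apply (𝕜 := ℝ) v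
  have hiψ := integrable_norm_sq hψ.continuous hψc
  have hi₁ : Integrable fun w => ‖α * ψ w + (I * fderiv ℝ φ w 1 + fderiv ℝ φ w I)‖ ^ 2 :=
    integrable_norm_sq ((continuous_const.mul hψ.continuous).add ((continuous_const.mul (hd 1)).add (hd I)))
      (hψc.mul_left.add ((hdc 1).mul_left.add (hdc I)))
  have hi₂ : Integrable fun w => ‖α * ψ w + (I * fderiv ℝ φ w 1 - fderiv ℝ φ w I)‖ ^ 2 :=
    integrable_norm_sq ((continuous_const.mul hψ.continuous).add ((continuous_const.mul (hd 1)).sub (hd I)))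
      (hψc.mul_left.add ((hdc 1).mul_left.sub (hdc I)))
  have hφs : ContDiff ℝ 2 fun w => star (φ w) := (starL' ℝ : ℂ ≃L[ℝ] ℂ).contDiff.comp hφ
  have hφsc : HasCompactSupport fun w => star (φ w) := hφc.comp_left (star_zero ℂ)
  have hprod : ContDiff ℝ 1 fun w => star (φ w) * ψ w := (hφs.mul hψ).of_le one_le_two
  have hprodc : HasCompactSupport fun w => star (φ w) * ψ w := hφsc.mul_right
  have hJ (v w : ℂ) : Integrable fun z => fderiv ℝ φ z v * star (fderiv ℝ φ z w) :=
    ((hd v).mul (hd w).star).integrable_of_hasCompactSupport (hdc v).mul_right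
  have hcomm : ∫ z, fderiv ℝ φ z 1 * star (fderiv ℝ φ z I)
      = ∫ z, fderiv ℝ φ z I * star (fderiv ℝ φ z 1) := by
    simpa only [fderiv_star_apply] using
      integral_fderiv_mul_fderiv_comm_s3 (μ := volume) hφ hφs hφsc 1 I
  have hprodI (w : ℂ) : fderiv ℝ (fun w => star (φ w) * ψ w) w I
      = star (fderiv ℝ φ w I) * ψ w + star (ψ w) * (fderiv ℝ φ w I) - star (ψ w) * ψ w := by
    have hψd := hψ.differentiable two_ne_zero w
    have hφI : fderiv ℝ φ w I = ψ w + w.im * fderiv ℝ ψ w I := by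
      have him : HasFDerivAt (fun z : ℂ => (z.im : ℂ)) (ofRealCLM.comp imCLM) w :=
        (ofRealCLM.comp imCLM).hasFDerivAt
      rw [funext h, fderiv_fun_mul him.differentiableAt hψd, him.fderiv]
      simp
      ring
    rw [fderiv_fun_mul (hφs.differentiable two_ne_zero w) hψd]
    simp only [add_apply, smul_apply, smul_eq_mul,
      fderiv_star_apply]
    rw [hφI, h w]
    simp
    ring
  have hpt (w : ℂ) : ‖α * ψ w + (I * fderiv ℝ φ w 1 + fderiv ℝ φ w I)‖ ^ 2
      - ‖α * ψ w + (I * fderiv ℝ φ w 1 - fderiv ℝ φ w I)‖ ^ 2 - 2 * α * ‖ψ w‖ ^ 2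
      = reCLM (2 * α * fderiv ℝ (fun w => star (φ w) * ψ w) w I
        + 2 * I * (fderiv ℝ φ w 1 * star (fderiv ℝ φ w I)
          - fderiv ℝ φ w I * star (fderiv ℝ φ w 1))) := by
    rw [hprodI]
    simp only [Complex.sq_norm, Complex.normSq_apply, reCLM_apply]
    simp
    ring
  have hi₃ : Integrable fun w => 2 * α * fderiv ℝ (fun w => star (φ w) * ψ w) w I :=
    (integrable_fderiv_apply hprod hprodc I).const_mul _
  have hi₄ : Integrable fun w => 2 * I * (fderiv ℝ φ w 1 * star (fderiv ℝ φ w I)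
      - fderiv ℝ φ w I * star (fderiv ℝ φ w 1)) := ((hJ 1 I).sub (hJ I 1)).const_mul _
  have hzero : ∫ w, (2 * α * fderiv ℝ (fun w => star (φ w) * ψ w) w I
      + 2 * I * (fderiv ℝ φ w 1 * star (fderiv ℝ φ w I)
        - fderiv ℝ φ w I * star (fderiv ℝ φ w 1))) = 0 := by
    rw [integral_add hi₃ hi₄, integral_const_mul, integral_const_mul,
      integral_sub (hJ 1 I) (hJ I 1), hcomm, integral_fderiv_apply_eq_zero_s3 hprod hprodc]
    simp
  have hint := congrArg reCLM hzero
  have hi₅ : Integrable fun w => 2 * α * fderiv ℝ (fun w => star (φ w) * ψ w) w I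
      + 2 * I * (fderiv ℝ φ w 1 * star (fderiv ℝ φ w I)
        - fderiv ℝ φ w I * star (fderiv ℝ φ w 1)) := hi₃.add hi₄
  rw [← reCLM.integral_comp_comm hi₅] at hint
  simp_rw [← hpt] at hint
  rw [integral_sub (by exact hi₁.sub hi₂) (hiψ.const_mul _), integral_sub hi₁ hi₂, integral_const_mul,
    map_zero] at hint
  linarith

/-- The `L²` norm on `D` with respect to the hyperbolic measure. -/
def hNorm (D : Set ℂ) (f : ℂ → ℂ) : ℝ≥0∞ :=
  eLpNorm (fun w => f w * ((w.im)⁻¹ : ℝ)) 2 (volume.restrict D)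

lemma hNormSq_eq_hNorm_sq (D : Set ℂ) (f : ℂ → ℂ) : hNormSq D f = hNorm D f ^ 2 := by
  have h := eLpNorm_nnreal_pow_eq_lintegral (p := 2) (μ := volume.restrict D)
    (f := fun w => f w * ((w.im)⁻¹ : ℝ)) two_ne_zero
  simp only [NNReal.coe_ofNat, ENNReal.rpow_ofNat, ENNReal.coe_ofNat] at h
  rw [hNorm, h, hNormSq]
  refine lintegral_congr fun w => ?_
  rw [enorm_mul, mul_pow, ← sq_abs (w.im)⁻¹, ENNReal.ofReal_pow (abs_nonneg _),
    ← Real.enorm_eq_ofReal_abs, enorm_eq_nnnorm]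
  congr 2
  simp [enorm_eq_nnnorm]

lemma hNorm_add_le {D : Set ℂ} {f g : ℂ → ℂ} (hf : AEStronglyMeasurable f (volume.restrict D))
    (hg : AEStronglyMeasurable g (volume.restrict D)) :
    hNorm D (fun w => f w + g w) ≤ hNorm D f + hNorm D g := by
  have hw : AEStronglyMeasurable (fun w : ℂ => (((w.im)⁻¹ : ℝ) : ℂ)) (volume.restrict D) :=
    (measurable_ofReal.comp measurable_im.inv).aestronglyMeasurable
  simp only [hNorm, add_mul]
  exact eLpNorm_add_le (hf.mul hw) (hg.mul hw) one_le_two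

lemma hNorm_sub_comm (D : Set ℂ) (f g : ℂ → ℂ) :
    hNorm D (fun w => f w - g w) = hNorm D (fun w => g w - f w) := by
  rw [hNorm, ← eLpNorm_neg, hNorm]
  congr 1
  ext w
  simp only [Pi.neg_apply]
  ring

lemma hNorm_const_mul (D : Set ℂ) (c : ℂ) (f : ℂ → ℂ) :
    hNorm D (fun w => c * f w) = ‖c‖ₑ * hNorm D f := by
  simp only [hNorm, mul_assoc]
  exact eLpNorm_const_smul c (fun w => f w * (((w.im)⁻¹ : ℝ) : ℂ)) 2 _

lemma tendsto_hNorm_zero {D : Set ℂ} {F : ℕ → ℂ → ℂ}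
    (h : Tendsto (fun n => hNormSq D (F n)) atTop (𝓝 0)) :
    Tendsto (fun n => hNorm D (F n)) atTop (𝓝 0) := by
  have h2 := (ENNReal.continuous_rpow_const (y := (1 / 2 : ℝ))).tendsto 0 |>.comp h
  rw [ENNReal.zero_rpow_of_pos (by norm_num)] at h2
  refine h2.congr fun n => ?_
  rw [Function.comp_apply, hNormSq_eq_hNorm_sq, ← ENNReal.rpow_natCast, ← ENNReal.rpow_mul]
  simp

lemma hNormSq_eq_ofReal_integral {D : Set ℂ} {f g : ℂ → ℂ}
    (hg : Continuous g) (hgc : HasCompactSupport g) (hgD : tsupport g ⊆ D) (hD : MeasurableSet D)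
    (hfg : ∀ w ∈ D, f w * ((w.im)⁻¹ : ℝ) = g w) :
    hNormSq D f = ENNReal.ofReal (∫ w, ‖g w‖ ^ 2) := by
  rw [ofReal_integral_eq_lintegral_ofReal (integrable_norm_sq hg hgc)
      (Eventually.of_forall fun _ => sq_nonneg _),
    ← setLIntegral_eq_of_support_subset (s := D), hNormSq]
  · refine setLIntegral_congr_fun hD fun w hw => ?_
    rw [← hfg w hw, norm_mul, mul_pow, ENNReal.ofReal_mul (sq_nonneg _),
      ENNReal.ofReal_pow (norm_nonneg _), ofReal_norm, enorm_eq_nnnorm]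
    simp
  · refine (Function.support_subset_iff'.2 fun w hw => ?_)
    simp [image_eq_zero_of_notMem_tsupport fun h => hw (hgD h)]

lemma IsTestFun.estimate {D : Set ℂ} (hD : IsOpen D) (hDU : D ⊆ UHP) {α : ℝ} (hα : 0 ≤ α)
    {φ : ℂ → ℂ} (hφ : IsTestFun D φ) :
    ENNReal.ofReal (2 * α) * hNormSq D φ ≤ hNormSq D (fun w => (α : ℂ) * φ w + Wop φ w) := by
  obtain ⟨hsm, hc, hsupp⟩ := hφ
  have hφ2 : ContDiff ℝ 2 φ := hsm.of_le (WithTop.coe_le_coe.2 (le_top (a := (2 : ℕ∞))))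
  set ψ : ℂ → ℂ := fun w => φ w * ((w.im)⁻¹ : ℝ) with hψdef
  have hψsupp : tsupport ψ ⊆ tsupport φ := tsupport_mul_subset_left
  have hψc : HasCompactSupport ψ := hc.mul_right
  have hψ : ContDiff ℝ 2 ψ := by
    refine contDiff_iff_contDiffAt.2 fun w => ?_
    by_cases hw : w ∈ tsupport ψ
    swap
    · exact contDiffAt_const.congr_of_eventuallyEq (notMem_tsupport_iff_eventuallyEq.1 hw)
    have him : w.im ≠ 0 := (hDU (hsupp (hψsupp hw))).ne'
    exact hφ2.contDiffAt.mul
      (ofRealCLM.contDiff.contDiffAt.comp w (imCLM.contDiff.contDiffAt.inv him))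
  have h (w : ℂ) : φ w = w.im * ψ w := by
    by_cases hw : w ∈ tsupport φ
    · have him : (w.im : ℂ) ≠ 0 := ofReal_ne_zero.2 (hDU (hsupp hw)).ne'
      simp only [hψdef, ofReal_inv]
      field_simp
    · simp [hψdef, image_eq_zero_of_notMem_tsupport hw]
  have hd (v : ℂ) : Continuous fun w => fderiv ℝ φ w v :=
    (hφ2.continuous_fderiv two_ne_zero).clm_apply continuous_const
  have hdc (v : ℂ) : HasCompactSupport fun w => fderiv ℝ φ w v := hc.fderiv_apply (𝕜 := ℝ) v
  rw [hNormSq_eq_ofReal_integral (g := ψ) hψ.continuous hψc (hψsupp.trans hsupp)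
      hD.measurableSet (fun _ _ => rfl),
    hNormSq_eq_ofReal_integral (D := D)
      (g := fun w => α * ψ w + (I * fderiv ℝ φ w 1 + fderiv ℝ φ w I))
      ((continuous_const.mul hψ.continuous).add ((continuous_const.mul (hd 1)).add (hd I)))
      (hψc.mul_left.add ((hdc 1).mul_left.add (hdc I))) ?_ hD.measurableSet ?_,
    ← ENNReal.ofReal_mul (by positivity), energy_identity hφ2 hψ hc hψc h α]
  · exact ENNReal.ofReal_le_ofReal (le_add_of_nonneg_right (integral_nonneg fun _ => sq_nonneg _))
  · refine (closure_minimal (Function.support_subset_iff'.2 fun w hw => ?_)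
      (isClosed_tsupport φ)).trans hsupp
    have hd0 (v : ℂ) : fderiv ℝ φ w v = 0 :=
      image_eq_zero_of_notMem_tsupport (f := fun z => fderiv ℝ φ z v)
        fun h => hw (tsupport_fderiv_apply_subset ℝ v h)
    simp [hψdef, image_eq_zero_of_notMem_tsupport hw, hd0]
  · intro w hw
    have him : (w.im : ℂ) ≠ 0 := ofReal_ne_zero.2 (hDU hw).ne'
    simp only [hψdef, Wop, dw, ofReal_inv]
    field_simp
    linear_combination -(w.im : ℂ) * fderiv ℝ φ w I * I_sq

/-- if `α ≥ 1/2` then `2α ‖u‖² ≤ ‖(α+W)u‖²` for all `u ∈ W₀`. -/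
theorem estimate_alpha_ge_half (D : Set ℂ) (hD : IsOpen D) (hDU : D ⊆ UHP)
    (hbd : Bornology.IsBounded D) (α : ℝ) (hα : 1 / 2 ≤ α)
    (u Wu Wbu : ℂ → ℂ) (hu : MemW0 D u Wu Wbu) :
    ENNReal.ofReal (2 * α) * hNormSq D u
      ≤ hNormSq D (fun w => (α : ℂ) * u w + Wu w) := by
  obtain ⟨hum, hWum, -, φ, hφ, hlim, hlimW, -⟩ := hu
  have hα0 : 0 ≤ α := by linarith
  set c : ℝ≥0∞ := ENNReal.ofReal √(2 * α)
  have hc2 : c ^ 2 = ENNReal.ofReal (2 * α) := by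
    rw [← ENNReal.ofReal_pow (Real.sqrt_nonneg _), Real.sq_sqrt (by positivity)]
  have hsq (f g : ℂ → ℂ) :
      ENNReal.ofReal (2 * α) * hNormSq D f ≤ hNormSq D g ↔ c * hNorm D f ≤ hNorm D g := by
    rw [hNormSq_eq_hNorm_sq, hNormSq_eq_hNorm_sq, ← hc2, ← mul_pow,
      ENNReal.pow_le_pow_left_iff two_ne_zero]
  rw [hsq]
  have hφm (n : ℕ) : AEStronglyMeasurable (φ n) (volume.restrict D) :=
    (hφ n).1.continuous.aestronglyMeasurable
  have hWφm (n : ℕ) : AEStronglyMeasurable (Wop (φ n)) (volume.restrict D) := by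
    have hd (v : ℂ) : Continuous fun w => fderiv ℝ (φ n) w v :=
      ((hφ n).1.continuous_fderiv (by simp)).clm_apply continuous_const
    have hd1 := hd 1
    have hdI := hd I
    have : Continuous (Wop (φ n)) := by
      unfold Wop dw
      fun_prop
    exact this.aestronglyMeasurable
  have hle (n : ℕ) : c * hNorm D u ≤ c * hNorm D (fun w => φ n w - u w)
      + (hNorm D (fun w => (α : ℂ) * u w + Wu w)
        + (‖(α : ℂ)‖ₑ * hNorm D (fun w => φ n w - u w)
          + hNorm D (fun w => Wop (φ n) w - Wu w))) := by
    have h1 : AEStronglyMeasurable (fun w => (α : ℂ) * (φ n w - u w)) (volume.restrict D) :=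
      ((hφm n).sub hum).const_mul _
    have h2 : AEStronglyMeasurable (fun w => Wop (φ n) w - Wu w) (volume.restrict D) :=
      (hWφm n).sub hWum
    have h3 : AEStronglyMeasurable (fun w => (α : ℂ) * u w + Wu w) (volume.restrict D) :=
      (hum.const_mul _).add hWum
    have h4 : AEStronglyMeasurable (fun w => u w - φ n w) (volume.restrict D) := hum.sub (hφm n)
    calc c * hNorm D u = c * hNorm D (fun w => (u w - φ n w) + φ n w) := by simp
      _ ≤ c * (hNorm D (fun w => u w - φ n w) + hNorm D (φ n)) :=
          mul_le_mul_right (hNorm_add_le h4 (hφm n)) _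
      _ = c * hNorm D (fun w => φ n w - u w) + c * hNorm D (φ n) := by
          rw [mul_add, hNorm_sub_comm]
      _ ≤ c * hNorm D (fun w => φ n w - u w)
            + hNorm D (fun w => (α : ℂ) * φ n w + Wop (φ n) w) :=
          add_le_add_right ((hsq _ _).1 ((hφ n).estimate hD hDU hα0)) _
      _ = c * hNorm D (fun w => φ n w - u w) + hNorm D (fun w => ((α : ℂ) * u w + Wu w)
            + ((α : ℂ) * (φ n w - u w) + (Wop (φ n) w - Wu w))) := by
          congr 2
          ext w
          ring
      _ ≤ _ := by
          rw [← hNorm_const_mul]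
          exact add_le_add_right ((hNorm_add_le h3 (h1.add h2)).trans
            (add_le_add_right (hNorm_add_le h1 h2) _)) _
  have hlim1 := tendsto_hNorm_zero hlim
  have hT := (ENNReal.Tendsto.const_mul (a := c) hlim1 (.inr ENNReal.ofReal_ne_top)).add
    ((tendsto_const_nhds (x := hNorm D fun w => (α : ℂ) * u w + Wu w)).add
      ((ENNReal.Tendsto.const_mul (a := ‖(α : ℂ)‖ₑ) hlim1 (.inr enorm_ne_top)).add
        (tendsto_hNorm_zero hlimW)))
  simp only [mul_zero, zero_add, add_zero] at hT
  exact ge_of_tendsto' hT hle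
end
end
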